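/- arXiv:1710.06342 — 7 statements merged into one kernel-verified Lean document; each statement's English description precedes it below -/
import Mathlib

section
/- Let g : [0,∞) → ℝ be continuously differentiable and nondecreasing and let Φ : ℝ → ℝ be continuously differentiable, strictly positive and nondecreasing. Then for every ε > 0 and every ℓ ≥ 0, one has ∑_{n=1}^{⌊ℓ/ε⌋} log( Φ(g(nε−ε)−ε) / Φ(g(nε)) ) = −∫_{0}^{ε⌊ℓ/ε⌋} (g′(a)+1) · Φ′(g(a)+a−ε⌈a/ε⌉)/Φ(g(a)+a−ε⌈a/ε⌉) da, where ⌊·⌋ and ⌈·⌉ denote the floor and ceiling functions. -/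
/-- On a single period `(kε, (k+1)ε]` the integrand agrees with the continuous function obtained
by replacing the ceiling with `k + 1`. -/
lemma eqOn_integrand_period (g Φ : ℝ → ℝ) {ε : ℝ} (hε : 0 < ε) (k : ℕ) :
    Set.EqOn
      (fun a => (deriv g a + 1) *
        (deriv Φ (g a + a - ε * (k + 1)) / Φ (g a + a - ε * (k + 1))))
      (fun a => (deriv g a + 1) *
        (deriv Φ (g a + a - ε * ⌈a / ε⌉₊) / Φ (g a + a - ε * ⌈a / ε⌉₊)))
      (Set.Ioc (k * ε) ((k + 1) * ε)) := by
  intro a ha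
  have hceil : ⌈a / ε⌉₊ = k + 1 := by
    rw [Nat.ceil_eq_iff (Nat.succ_ne_zero k), lt_div_iff₀ hε, div_le_iff₀ hε]
    simpa using ha
  simp [hceil]

/-- The integrand is interval integrable on a single period, and its integral there is the
increment of `log Φ(g(a) + a - ε(k + 1))`. -/
lemma integral_integrand_period {g Φ : ℝ → ℝ} (hg : ContDiff ℝ 1 g) (hΦ : ContDiff ℝ 1 Φ)
    (hΦ_pos : ∀ x, 0 < Φ x) {ε : ℝ} (hε : 0 < ε) (k : ℕ) :
    IntervalIntegrable
      (fun a => (deriv g a + 1) *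
        (deriv Φ (g a + a - ε * ⌈a / ε⌉₊) / Φ (g a + a - ε * ⌈a / ε⌉₊)))
      MeasureTheory.volume (k * ε) ((k + 1) * ε) ∧
    ∫ a in (k * ε)..((k + 1) * ε),
        (deriv g a + 1) *
          (deriv Φ (g a + a - ε * ⌈a / ε⌉₊) / Φ (g a + a - ε * ⌈a / ε⌉₊)) =
      Real.log (Φ (g ((k + 1) * ε))) - Real.log (Φ (g (k * ε) - ε)) := by
  have hle : k * ε ≤ (k + 1) * ε := by nlinarith
  have heq := eqOn_integrand_period g Φ hε k
  rw [← Set.uIoc_of_le hle] at heq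
  have hg' : Continuous (deriv g) := hg.continuous_deriv le_rfl
  have hΦ' : Continuous (deriv Φ) := hΦ.continuous_deriv le_rfl
  have hshift : Continuous fun a => g a + a - ε * (k + 1) := by
    have := hg.continuous
    fun_prop
  have hcont : Continuous fun a => (deriv g a + 1) *
      (deriv Φ (g a + a - ε * (k + 1)) / Φ (g a + a - ε * (k + 1))) :=
    (hg'.add continuous_const).mul
      ((hΦ'.comp hshift).div (hΦ.continuous.comp hshift) fun a => (hΦ_pos _).ne')
  have hint := hcont.intervalIntegrable (μ := MeasureTheory.volume) (k * ε) ((k + 1) * ε)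
  refine ⟨hint.congr heq, ?_⟩
  have hderiv : ∀ a ∈ Set.uIcc (k * ε) ((k + 1) * ε),
      HasDerivAt (fun a => Real.log (Φ (g a + a - ε * (k + 1))))
        ((deriv g a + 1) *
          (deriv Φ (g a + a - ε * (k + 1)) / Φ (g a + a - ε * (k + 1)))) a := by
    intro a _
    have hgd := (hg.differentiable one_ne_zero a).hasDerivAt
    have hinner := (hgd.add (hasDerivAt_id a)).sub_const (ε * (k + 1))
    have hΦd := (hΦ.differentiable one_ne_zero (g a + a - ε * (k + 1))).hasDerivAt
    have hlog := (hΦd.comp a hinner).log (hΦ_pos _).ne'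
    refine hlog.congr_deriv ?_
    change _ / Φ (g a + a - ε * (k + 1)) = _
    ring
  rw [← intervalIntegral.integral_congr_ae (Filter.Eventually.of_forall heq),
    intervalIntegral.integral_eq_sub_of_hasDerivAt hderiv hint]
  congr 3 <;> ring_nf


/-- For `g` C¹ nondecreasing on `[0,∞)` and `Φ` C¹, strictly positive and
nondecreasing, for every `ε > 0` and `ℓ ≥ 0`:
`∑_{n=1}^{⌊ℓ/ε⌋} log( Φ(g(nε−ε)−ε) / Φ(g(nε)) )
  = −∫_0^{ε⌊ℓ/ε⌋} (g′(a)+1) · Φ′(g(a)+a−ε⌈a/ε⌉)/Φ(g(a)+a−ε⌈a/ε⌉) da`. -/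
theorem stmt1 (g Φ : ℝ → ℝ)
    (hg : ContDiff ℝ 1 g) (hg_mono : MonotoneOn g (Set.Ici (0 : ℝ)))
    (hΦ : ContDiff ℝ 1 Φ) (hΦ_pos : ∀ x, 0 < Φ x) (hΦ_mono : Monotone Φ)
    (ε ℓ : ℝ) (hε : 0 < ε) (hℓ : 0 ≤ ℓ) :
    ∑ n ∈ Finset.Icc 1 ⌊ℓ / ε⌋₊,
        Real.log (Φ (g ((n : ℝ) * ε - ε) - ε) / Φ (g ((n : ℝ) * ε))) =
      -∫ a in (0 : ℝ)..(ε * ⌊ℓ / ε⌋₊),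
        (deriv g a + 1) *
          (deriv Φ (g a + a - ε * ⌈a / ε⌉₊) / Φ (g a + a - ε * ⌈a / ε⌉₊)) := by
  have hint := integral_integrand_period hg hΦ hΦ_pos hε
  have hsum := intervalIntegral.sum_integral_adjacent_intervals
    (a := fun k : ℕ => (k : ℝ) * ε) (n := ⌊ℓ / ε⌋₊) (μ := MeasureTheory.volume)
    (f := fun a => (deriv g a + 1) *
      (deriv Φ (g a + a - ε * ⌈a / ε⌉₊) / Φ (g a + a - ε * ⌈a / ε⌉₊)))
    (fun k _ => by simpa using (hint k).1)
  simp only [Nat.cast_zero, zero_mul, Nat.cast_add, Nat.cast_one] at hsum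
  rw [mul_comm ε, ← hsum, ← Finset.sum_neg_distrib, ← Finset.Ico_add_one_right_eq_Icc,
    Finset.sum_Ico_eq_sum_range]
  refine Finset.sum_congr (by simp) fun k _ => ?_
  rw [(hint k).2, Real.log_div (hΦ_pos _).ne' (hΦ_pos _).ne', neg_sub]
  push_cast
  congr 4 <;> ring_nf
end

section
/- Let g : [0,∞) → ℝ be continuously differentiable and nondecreasing and let Φ : ℝ → ℝ be continuously differentiable, strictly positive and nondecreasing. Then for every ℓ ≥ 0, lim_{ε→0⁺} ∑_{n=1}^{⌊ℓ/ε⌋} log( Φ(g(nε−ε)−ε) / Φ(g(nε)) ) = −∫_{0}^{ℓ} (g′(a)+1) · Φ′(g(a))/Φ(g(a)) da, where ⌊·⌋ denotes the floor function. -/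
open Filter

/-- For a continuous `ψ` and `g`, the increments `ψ (g (t + s)) - ψ (g t - s)` are small for
small `s`, uniformly for `t` in a compact set. -/
theorem eventually_forall_abs_comp_add_sub_comp_sub_le {g ψ : ℝ → ℝ} (hg : Continuous g)
    (hψ : Continuous ψ) {K : Set ℝ} (hK : IsCompact K) {δ : ℝ} (hδ : 0 < δ) :
    ∀ᶠ s in nhds (0 : ℝ), ∀ t ∈ K, |ψ (g (t + s)) - ψ (g t - s)| ≤ δ := by
  apply hK.eventually_forall_of_forall_eventually
  intro t _
  have hc : Continuous fun z : ℝ × ℝ => |ψ (g (z.2 + z.1)) - ψ (g z.2 - z.1)| := by fun_prop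
  have h := hc.tendsto (0, t)
  simp only [add_zero, sub_zero, sub_self, abs_zero] at h
  filter_upwards [h.eventually (gt_mem_nhds hδ)] with z hz using hz.le

/-- One step of the discretisation: if `ψ` is the derivative of `L` and `F` has derivative
`(g' + 1) * ψ ∘ g`, then `L (g t - ε) - L (g (t + ε))` is close to `F t - F (t + ε)`. -/
theorem abs_step_le {g g' L ψ F : ℝ → ℝ} (hg : ∀ x, HasDerivAt g (g' x) x)
    (hL : ∀ x, HasDerivAt L (ψ x) x) (hF : ∀ x, HasDerivAt F ((g' x + 1) * ψ (g x)) x)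
    {t ε δ : ℝ} (hε : 0 ≤ ε)
    (hδ : ∀ s ∈ Set.Ico 0 ε, |ψ (g (t + s)) - ψ (g t - s)| ≤ δ) :
    |L (g t - ε) - L (g (t + ε)) + F (t + ε) - F t| ≤ δ * ε := by
  have hd : ∀ s, HasDerivAt (fun s => L (g t - s) - L (g (t + s)) + F (t + s))
      (ψ (g (t + s)) - ψ (g t - s)) s := by
    intro s
    have hadd : HasDerivAt (fun s => t + s) 1 s := (hasDerivAt_id s).const_add t
    have hsub : HasDerivAt (fun s => g t - s) (-1) s := (hasDerivAt_id s).const_sub (g t)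
    have h1 := (hL (g t - s)).comp s hsub
    have h2 := (hL (g (t + s))).comp s ((hg (t + s)).comp s hadd)
    have h3 := (hF (t + s)).comp s hadd
    exact ((h1.sub h2).add h3).congr_deriv (by ring)
  have h := norm_image_sub_le_of_norm_deriv_le_segment' (C := δ)
    (fun s _ => (hd s).hasDerivWithinAt) (fun s hs => by simpa using hδ s hs) ε
    (Set.right_mem_Icc.2 hε)
  simpa using h

/-- The accumulated error after `m` steps of size `ε`. -/
theorem abs_sum_add_le {g L F : ℝ → ℝ} {ℓ ε δ : ℝ} (hε : 0 ≤ ε) (hF0 : F 0 = 0)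
    (hstep : ∀ t ∈ Set.Icc 0 ℓ, |L (g t - ε) - L (g (t + ε)) + F (t + ε) - F t| ≤ δ * ε) (m : ℕ)
    (hm : m * ε ≤ ℓ) :
    |∑ n ∈ Finset.Icc 1 m, (L (g ((n : ℝ) * ε - ε) - ε) - L (g ((n : ℝ) * ε))) + F (m * ε)|
      ≤ m * (δ * ε) := by
  induction m with
  | zero => simp [hF0]
  | succ m ih =>
    push_cast at hm
    have hmε : (m : ℝ) * ε ≤ ℓ := by linarith
    have h1 := abs_le.1 (ih hmε)
    have h2 := abs_le.1 (hstep (m * ε) ⟨by positivity, hmε⟩)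
    rw [Finset.sum_Icc_succ_top (by omega)]
    push_cast
    rw [show ((m : ℝ) + 1) * ε - ε = m * ε by ring, show ((m : ℝ) + 1) * ε = m * ε + ε by ring]
    rw [abs_le]
    constructor <;> linarith [h1.1, h1.2, h2.1, h2.2]

theorem tendsto_floor_div_mul_self {ℓ : ℝ} (hℓ : 0 ≤ ℓ) :
    Tendsto (fun ε : ℝ => (⌊ℓ / ε⌋₊ : ℝ) * ε) (nhdsWithin 0 (Set.Ioi 0)) (nhds ℓ) := by
  have hlow : Tendsto (fun ε : ℝ => ℓ - ε) (nhdsWithin 0 (Set.Ioi 0)) (nhds ℓ) := by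
    have h : Continuous fun ε : ℝ => ℓ - ε := by fun_prop
    simpa using (h.tendsto 0).mono_left nhdsWithin_le_nhds
  refine tendsto_of_tendsto_of_tendsto_of_le_of_le' hlow tendsto_const_nhds ?_ ?_
  · filter_upwards [self_mem_nhdsWithin] with ε hε
    have h := (div_lt_iff₀ hε).1 (Nat.lt_floor_add_one (ℓ / ε))
    linarith
  · filter_upwards [self_mem_nhdsWithin] with ε (hε : 0 < ε)
    exact (le_div_iff₀ hε).1 (Nat.floor_le (by positivity))

/-- For `g` C¹ nondecreasing on `[0,∞)` and `Φ` C¹, strictly positive and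
nondecreasing, for every `ℓ ≥ 0`:
`lim_{ε→0⁺} ∑_{n=1}^{⌊ℓ/ε⌋} log( Φ(g(nε−ε)−ε)/Φ(g(nε)) )
  = −∫_0^ℓ (g′(a)+1) · Φ′(g(a))/Φ(g(a)) da`. -/
theorem stmt3 (g Φ : ℝ → ℝ)
    (hg : ContDiff ℝ 1 g) (hg_mono : MonotoneOn g (Set.Ici (0 : ℝ)))
    (hΦ : ContDiff ℝ 1 Φ) (hΦ_pos : ∀ x, 0 < Φ x) (hΦ_mono : Monotone Φ)
    (ℓ : ℝ) (hℓ : 0 ≤ ℓ) :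
    Tendsto
      (fun ε : ℝ =>
        ∑ n ∈ Finset.Icc 1 ⌊ℓ / ε⌋₊,
          Real.log (Φ (g ((n : ℝ) * ε - ε) - ε) / Φ (g ((n : ℝ) * ε))))
      (nhdsWithin 0 (Set.Ioi 0))
      (nhds (-∫ a in (0 : ℝ)..ℓ, (deriv g a + 1) * (deriv Φ (g a) / Φ (g a)))) := by
  have hg' : ∀ x, HasDerivAt g (deriv g x) x := fun x =>
    (hg.differentiable one_ne_zero x).hasDerivAt
  have hL : ∀ x, HasDerivAt (fun x => Real.log (Φ x)) (deriv Φ x / Φ x) x := fun x =>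
    (hΦ.differentiable one_ne_zero x).hasDerivAt.log (hΦ_pos x).ne'
  have hψ : Continuous fun x => deriv Φ x / Φ x :=
    (hΦ.continuous_deriv le_rfl).div hΦ.continuous fun x => (hΦ_pos x).ne'
  have hf : Continuous fun a => (deriv g a + 1) * (deriv Φ (g a) / Φ (g a)) :=
    ((hg.continuous_deriv le_rfl).add continuous_const).mul (hψ.comp hg.continuous)
  set F : ℝ → ℝ := fun t => ∫ a in (0 : ℝ)..t, (deriv g a + 1) * (deriv Φ (g a) / Φ (g a))
    with hFdef
  have hF : ∀ x, HasDerivAt F ((deriv g x + 1) * (deriv Φ (g x) / Φ (g x))) x := fun x =>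
    hf.integral_hasStrictDerivAt 0 x |>.hasDerivAt
  have hF0 : F 0 = 0 := by simp [hFdef]
  have hlim : Tendsto (fun ε : ℝ => -F ((⌊ℓ / ε⌋₊ : ℝ) * ε)) (nhdsWithin 0 (Set.Ioi 0))
      (nhds (-F ℓ)) :=
    ((hF ℓ).continuousAt.tendsto.comp (tendsto_floor_div_mul_self hℓ)).neg
  refine hlim.congr_dist ?_
  rw [Metric.tendsto_nhds]
  intro η hη
  have hδ : 0 < η / (ℓ + 1) := by positivity
  obtain ⟨r, hr, hball⟩ := Metric.eventually_nhds_iff.1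
    (eventually_forall_abs_comp_add_sub_comp_sub_le hg.continuous hψ
      (isCompact_Icc (a := 0) (b := ℓ)) hδ)
  filter_upwards [Ioo_mem_nhdsGT hr] with ε ⟨hε, hεr⟩
  have hNε : (⌊ℓ / ε⌋₊ : ℝ) * ε ≤ ℓ := (le_div_iff₀ hε).1 (Nat.floor_le (by positivity))
  have hsum := abs_sum_add_le (L := fun x => Real.log (Φ x)) hε.le hF0
    (fun t ht => abs_step_le hg' hL hF hε.le fun s hs => hball (y := s)
      (by rw [Real.dist_eq, sub_zero, abs_of_nonneg hs.1]; exact hs.2.trans hεr) t ht) _ hNε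
  have hlog : ∀ x y, Real.log (Φ x / Φ y) = Real.log (Φ x) - Real.log (Φ y) := fun x y =>
    Real.log_div (hΦ_pos x).ne' (hΦ_pos y).ne'
  simp only [hlog]
  rw [Real.dist_0_eq_abs, abs_of_nonneg dist_nonneg, dist_comm, Real.dist_eq, sub_neg_eq_add]
  calc _ ≤ _ := hsum
    _ = (⌊ℓ / ε⌋₊ * ε) * (η / (ℓ + 1)) := by ring
    _ ≤ ℓ * (η / (ℓ + 1)) := by gcongr
    _ < (ℓ + 1) * (η / (ℓ + 1)) := by gcongr; linarith
    _ = η := by field_simp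
end

section
/- Let Φ : ℝ → ℝ be continuously differentiable and strictly positive, let I ⊆ ℝ be a nonempty compact set, let ε₀ > 0, let (xₙ) be a sequence in I, and let (εₙ) be a sequence of positive reals with εₙ → 0. Set Nₙ := ⌈ε₀/εₙ⌉ (the ceiling). Then limsup_{n→∞} ( Φ(xₙ − εₙ)/Φ(xₙ) )^{Nₙ − 1} ≤ sup_{x ∈ I} exp( −ε₀ · Φ′(x)/Φ(x) ). -/
open Filter

/-- The power in the theorem, written through the logarithmic derivative at an intermediate point. -/
theorem exists_div_pow_eq_exp {Φ : ℝ → ℝ} (hΦ : Differentiable ℝ Φ) (hΦ_pos : ∀ x, 0 < Φ x)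
    (a : ℝ) {h : ℝ} (hh : 0 < h) :
    ∃ ξ ∈ Set.Ioo (a - h) a, ∀ k : ℕ,
      (Φ (a - h) / Φ a) ^ k = Real.exp (-(k * h) * (deriv Φ ξ / Φ ξ)) := by
  have hd : ∀ y, HasDerivAt (fun z => Real.log (Φ z)) (deriv Φ y / Φ y) y := fun y =>
    (hΦ y).hasDerivAt.log (hΦ_pos y).ne'
  obtain ⟨ξ, hξ, hslope⟩ := exists_hasDerivAt_eq_slope (fun z => Real.log (Φ z))
    (fun y => deriv Φ y / Φ y) (sub_lt_self a hh)
    (fun y _ => (hd y).continuousAt.continuousWithinAt) (fun y _ => hd y)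
  refine ⟨ξ, hξ, fun k => ?_⟩
  have hlog : Real.log (Φ (a - h) / Φ a) = -h * (deriv Φ ξ / Φ ξ) := by
    rw [Real.log_div (hΦ_pos _).ne' (hΦ_pos _).ne', hslope, sub_sub_cancel]
    field_simp
    ring
  rw [← Real.exp_log (div_pos (hΦ_pos (a - h)) (hΦ_pos a)), hlog, ← Real.exp_nat_mul]
  ring_nf

/-- A continuous function has asymptotically equal values along a sequence in a compact set and
along any sequence asymptotic to it. -/
theorem IsCompact.tendsto_sub_of_tendsto_dist {g : ℝ → ℝ} (hg : Continuous g) {I : Set ℝ}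
    (hI : IsCompact I) {x ξ : ℕ → ℝ} (hx : ∀ n, x n ∈ I)
    (h : Tendsto (fun n => dist (x n) (ξ n)) atTop (nhds 0)) :
    Tendsto (fun n => g (x n) - g (ξ n)) atTop (nhds 0) := by
  rw [Metric.tendsto_atTop]
  intro η hη
  have hunif := hI.uniformContinuousAt_of_continuousAt g (fun a _ => hg.continuousAt)
    (Metric.dist_mem_uniformity hη)
  obtain ⟨δ, hδ, hsub⟩ := Metric.mem_uniformity_dist.1 hunif
  obtain ⟨n₀, hn₀⟩ := eventually_atTop.1 (h.eventually_lt_const hδ)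
  refine ⟨n₀, fun n hn => ?_⟩
  simpa [Real.dist_eq] using hsub (hn₀ n hn) (hx n)

/-- Grid rounding: `(⌈c / h⌉ - 1) h` lies in `[c - h, c]`. -/
theorem ceil_div_sub_one_mul_mem_Icc {c h : ℝ} (hc : 0 < c) (hh : 0 < h) :
    ((⌈c / h⌉₊ - 1 : ℕ) : ℝ) * h ∈ Set.Icc (c - h) c := by
  have hpos : 1 ≤ ⌈c / h⌉₊ := Nat.ceil_pos.2 (div_pos hc hh)
  have hlow := (div_le_iff₀ hh).1 (Nat.le_ceil (c / h))
  have hupp := Nat.ceil_lt_add_one (div_pos hc hh).le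
  have hupp' : ((⌈c / h⌉₊ : ℝ) - 1) * h ≤ c := (le_div_iff₀ hh).1 (by linarith)
  rw [Nat.cast_sub hpos, Nat.cast_one]
  exact ⟨by linarith, hupp'⟩

/-- Let `Φ : ℝ → ℝ` be continuously differentiable and strictly positive,
`I ⊆ ℝ` nonempty compact, `ε₀ > 0`, `(xₙ)` a sequence in `I`, and `(εₙ)` positive with
`εₙ → 0`.  With `Nₙ := ⌈ε₀/εₙ⌉`,
`limsup_{n→∞} (Φ(xₙ−εₙ)/Φ(xₙ))^{Nₙ−1} ≤ sup_{x∈I} exp(−ε₀·Φ′(x)/Φ(x))`. -/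
theorem stmt6 (Φ : ℝ → ℝ) (hΦ : ContDiff ℝ 1 Φ) (hΦ_pos : ∀ x, 0 < Φ x)
    (I : Set ℝ) (hI : IsCompact I) (hIne : I.Nonempty)
    (ε₀ : ℝ) (hε₀ : 0 < ε₀)
    (x : ℕ → ℝ) (hx : ∀ n, x n ∈ I)
    (ε : ℕ → ℝ) (hε_pos : ∀ n, 0 < ε n) (hε_lim : Tendsto ε atTop (nhds 0)) :
    Filter.limsup
        (fun n => (Φ (x n - ε n) / Φ (x n)) ^ (⌈ε₀ / ε n⌉₊ - 1)) atTop
      ≤ ⨆ y ∈ I, Real.exp (-ε₀ * (deriv Φ y / Φ y)) := by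
  set g : ℝ → ℝ := fun y => deriv Φ y / Φ y
  have hg : Continuous g :=
    (hΦ.continuous_deriv le_rfl).div hΦ.continuous fun y => (hΦ_pos y).ne'
  choose ξ hξ hpow using fun n =>
    exists_div_pow_eq_exp (hΦ.differentiable one_ne_zero) hΦ_pos (x n) (hε_pos n)
  set s : ℕ → ℝ := fun n => ((⌈ε₀ / ε n⌉₊ - 1 : ℕ) : ℝ) * ε n
  have hs : ∀ n, s n ∈ Set.Icc (ε₀ - ε n) ε₀ := fun n =>
    ceil_div_sub_one_mul_mem_Icc hε₀ (hε_pos n)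
  have hs_lim : Tendsto s atTop (nhds ε₀) :=
    tendsto_of_tendsto_of_tendsto_of_le_of_le (by simpa using hε_lim.const_sub ε₀)
      tendsto_const_nhds (fun n => (hs n).1) (fun n => (hs n).2)
  have hgx : Tendsto (fun n => g (x n) - g (ξ n)) atTop (nhds 0) := by
    refine hI.tendsto_sub_of_tendsto_dist hg hx (squeeze_zero (fun _ => dist_nonneg) ?_ hε_lim)
    intro n
    rw [Real.dist_eq, abs_of_pos (sub_pos.2 (hξ n).2)]
    linarith [(hξ n).1]
  obtain ⟨C, hC⟩ := hI.exists_bound_of_continuousOn hg.continuousOn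
  have hrem : Tendsto (fun n => (ε₀ - s n) * g (x n)) atTop (nhds 0) := by
    refine Tendsto.zero_mul_isBoundedUnder_le (by simpa using hs_lim.const_sub ε₀) ?_
    exact isBoundedUnder_of ⟨C, fun n => hC _ (hx n)⟩
  set M := ⨆ y ∈ I, Real.exp (-ε₀ * g y)
  have hbdd : BddAbove (Set.range fun y => ⨆ _ : y ∈ I, Real.exp (-ε₀ * g y)) := by
    refine ⟨Real.exp (ε₀ * C), ?_⟩
    rintro _ ⟨y, rfl⟩
    refine Real.iSup_le (fun hy => Real.exp_le_exp.2 ?_) (Real.exp_pos _).le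
    nlinarith [neg_le_of_abs_le (hC y hy)]
  have hle : ∀ n, Real.exp (-ε₀ * g (x n)) ≤ M := fun n => by
    refine le_trans (le_of_eq ?_) (le_ciSup hbdd (x n))
    have : Nonempty (x n ∈ I) := ⟨hx n⟩
    exact (ciSup_const (ι := x n ∈ I)).symm
  have hmaj : Tendsto
      (fun n => M * Real.exp (s n * (g (x n) - g (ξ n)) + (ε₀ - s n) * g (x n)))
      atTop (nhds M) := by
    have hexponent := (hs_lim.mul hgx).add hrem
    simpa using (hexponent.rexp).const_mul M
  refine (limsup_le_limsup (Eventually.of_forall fun n => ?_) ?_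
    hmaj.isBoundedUnder_le).trans_eq hmaj.limsup_eq
  · calc (Φ (x n - ε n) / Φ (x n)) ^ (⌈ε₀ / ε n⌉₊ - 1)
        = Real.exp (-s n * g (ξ n)) := hpow n _
      _ = Real.exp (-ε₀ * g (x n)) *
            Real.exp (s n * (g (x n) - g (ξ n)) + (ε₀ - s n) * g (x n)) := by
          rw [← Real.exp_add]
          ring_nf
      _ ≤ _ := mul_le_mul_of_nonneg_right (hle n) (Real.exp_pos _).le
  · exact (isBoundedUnder_of ⟨0, fun n =>
      pow_nonneg (div_pos (hΦ_pos _) (hΦ_pos _)).le _⟩ :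
        IsBoundedUnder (· ≥ ·) atTop _).isCoboundedUnder_le
end

section
/- Let Ω be a probability space, let S and T be Polish spaces equipped with their Borel σ-algebras, let Xₙ : Ω → S (n ∈ ℕ) and W : Ω → T be measurable, and let H : T → S be Borel measurable. If the laws of the pairs (Xₙ, W) on S × T converge weakly to the law of (H∘W, W), then for every bounded continuous function F : S → ℝ one has E[ (F(Xₙ) − F(H(W)))² ] → 0 as n → ∞. -/
open Filter MeasureTheory

/-- Let `Ω` be a probability space, `S, T` Polish spaces with their Borel
σ-algebras, `Xₙ : Ω → S`, `W : Ω → T` measurable and `H : T → S` Borel measurable.  If the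
laws of `(Xₙ, W)` converge weakly to the law of `(H∘W, W)` (i.e. integrals of all bounded
continuous functions converge), then for every bounded continuous `F : S → ℝ` one has
`E[(F(Xₙ) − F(H(W)))²] → 0`. -/
theorem stmt7 {Ω : Type*} [MeasurableSpace Ω] (P : Measure Ω) [IsProbabilityMeasure P]
    {S : Type*} [MetricSpace S] [CompleteSpace S] [TopologicalSpace.SeparableSpace S]
    [MeasurableSpace S] [BorelSpace S]
    {T : Type*} [MetricSpace T] [CompleteSpace T] [TopologicalSpace.SeparableSpace T]
    [MeasurableSpace T] [BorelSpace T]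
    (X : ℕ → Ω → S) (W : Ω → T) (H : T → S)
    (hX : ∀ n, Measurable (X n)) (hW : Measurable W) (hH : Measurable H)
    (hweak : ∀ f : BoundedContinuousFunction (S × T) ℝ,
      Tendsto (fun n => ∫ ω, f (X n ω, W ω) ∂P) atTop
        (nhds (∫ ω, f (H (W ω), W ω) ∂P))) :
    ∀ F : BoundedContinuousFunction S ℝ,
      Tendsto (fun n => ∫ ω, (F (X n ω) - F (H (W ω))) ^ 2 ∂P) atTop (nhds 0) := by
  intro F
  have int_sq : ∀ {Y Z : Ω → ℝ} (a b : ℝ), Measurable Y → Measurable Z →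
      (∀ ω, ‖Y ω‖ ≤ a) → (∀ ω, ‖Z ω‖ ≤ b) → Integrable (fun ω => (Y ω - Z ω) ^ 2) P := by
    intro Y Z a b hY hZ ha hb
    refine Integrable.of_bound ((hY.sub hZ).pow_const 2).aestronglyMeasurable ((a + b) ^ 2)
      (Eventually.of_forall fun ω => ?_)
    rw [norm_pow]
    gcongr
    exact (norm_sub_le _ _).trans (add_le_add (ha ω) (hb ω))
  have hFX : ∀ n, Measurable fun ω => F (X n ω) := fun n =>
    F.continuous.measurable.comp (hX n)
  have hFH : Measurable fun t => F (H t) := F.continuous.measurable.comp hH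
  have hFHW : Measurable fun ω => F (H (W ω)) := hFH.comp hW
  have : IsProbabilityMeasure (P.map W) := Measure.isProbabilityMeasure_map hW.aemeasurable
  have hmem : MemLp (fun t => F (H t)) (ENNReal.ofReal 2) (P.map W) :=
    MemLp.of_bound hFH.aestronglyMeasurable ‖F‖ (Eventually.of_forall fun t => F.norm_coe_le_norm _)
  rw [Metric.tendsto_atTop']
  intro ε hε
  obtain ⟨g, hg, -⟩ := hmem.exists_boundedContinuous_integral_rpow_sub_le
    (by norm_num : (0 : ℝ) < 2) (by positivity : 0 < ε / 8)
  have hgW : Measurable fun ω => g (W ω) := g.continuous.measurable.comp hW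
  have hgε : ∫ ω, (F (H (W ω)) - g (W ω)) ^ 2 ∂P ≤ ε / 8 := by
    rw [integral_map hW.aemeasurable (by
      exact ((hFH.sub g.continuous.measurable).norm.pow_const _).aestronglyMeasurable)] at hg
    simpa using hg
  have hlim := hweak ((F.compContinuous ⟨Prod.fst, continuous_fst⟩ -
    g.compContinuous ⟨Prod.snd, continuous_snd⟩) ^ 2)
  simp only [BoundedContinuousFunction.coe_pow, BoundedContinuousFunction.coe_sub, Pi.pow_apply,
    Pi.sub_apply, BoundedContinuousFunction.compContinuous_apply, ContinuousMap.coe_mk] at hlim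
  obtain ⟨N, hN⟩ := eventually_atTop.1
    (hlim.eventually (gt_mem_nhds (show _ < ε / 4 by linarith)))
  refine ⟨N, fun n hn => ?_⟩
  have i₁ := int_sq _ _ (hFX n) hgW (fun ω => F.norm_coe_le_norm _) (fun ω => g.norm_coe_le_norm _)
  have i₂ := int_sq _ _ hFHW hgW (fun ω => F.norm_coe_le_norm _) (fun ω => g.norm_coe_le_norm _)
  have i₃ := int_sq _ _ (hFX n) hFHW (fun ω => F.norm_coe_le_norm _)
    (fun ω => F.norm_coe_le_norm _)
  have key : ∫ ω, (F (X n ω) - F (H (W ω))) ^ 2 ∂P ≤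
      2 * ∫ ω, (F (X n ω) - g (W ω)) ^ 2 ∂P + 2 * ∫ ω, (F (H (W ω)) - g (W ω)) ^ 2 ∂P := by
    rw [← integral_const_mul, ← integral_const_mul,
      ← integral_add (i₁.const_mul 2) (i₂.const_mul 2)]
    refine integral_mono i₃ ((i₁.const_mul 2).add (i₂.const_mul 2)) fun ω => ?_
    dsimp only
    nlinarith [sq_nonneg (F (X n ω) - g (W ω) + (F (H (W ω)) - g (W ω)))]
  rw [Real.dist_eq, sub_zero, abs_of_nonneg (integral_nonneg fun ω => sq_nonneg _)]
  linarith [hN n hn.le]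
end

section
/- Let Ω be a probability space, let S and T be Polish spaces equipped with their Borel σ-algebras, where S carries a complete metric dist, let Xₙ : Ω → S (n ∈ ℕ) and W : Ω → T be measurable, and let H : T → S be Borel measurable. If the laws of the pairs (Xₙ, W) on S × T converge weakly to the law of (H∘W, W), then Xₙ converges to H∘W in probability, i.e. for every δ > 0, P[ dist(Xₙ, H(W)) > δ ] → 0 as n → ∞. -/
open Filter MeasureTheory

open scoped BoundedContinuousFunction Topology

/-- The difference between `∫ f(Y) ψ(W)` and `∫ f(Y) g(W)` is controlled by the sup norm of `f` and
the `L¹` distance between `ψ` and `g` under the law of `W`. -/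
lemma abs_integral_mul_sub_integral_mul_le {Ω S T : Type*} [MeasurableSpace Ω] {P : Measure Ω}
    [TopologicalSpace S] [MeasurableSpace S] [OpensMeasurableSpace S] [MeasurableSpace T]
    {Y : Ω → S} {W : Ω → T} (hY : Measurable Y) (hW : Measurable W)
    (f : S →ᵇ ℝ) {ψ g : T → ℝ} (hψ : Integrable ψ (P.map W)) (hg : Integrable g (P.map W)) :
    |∫ ω, f (Y ω) * ψ (W ω) ∂P - ∫ ω, f (Y ω) * g (W ω) ∂P| ≤
      ‖f‖ * ∫ x, ‖ψ x - g x‖ ∂(P.map W) := by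
  have hfm : AEStronglyMeasurable (fun ω => f (Y ω)) P :=
    (f.continuous.measurable.comp hY).aestronglyMeasurable
  have hmul : ∀ {h : T → ℝ}, Integrable h (P.map W) →
      Integrable (fun ω => f (Y ω) * h (W ω)) P := fun h =>
    (h.comp_measurable hW).bdd_mul hfm (.of_forall fun ω => f.norm_coe_le_norm (Y ω))
  have hint := ((hψ.sub hg).norm).comp_measurable hW
  rw [← integral_sub (hmul hψ) (hmul hg), ← Real.norm_eq_abs,
    integral_map (f := fun x => ‖ψ x - g x‖) hW.aemeasurable
      (hψ.sub hg).norm.aestronglyMeasurable, ← integral_const_mul]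
  refine norm_integral_le_of_norm_le (hint.const_mul _) (.of_forall fun ω => ?_)
  rw [← mul_sub, norm_mul]
  exact mul_le_mul_of_nonneg_right (f.norm_coe_le_norm _) (norm_nonneg _)

/-- If the laws of `(Xₙ, W)` converge weakly to the law of `(Y, W)`, then the convergence of
integrals extends to test functions `f(x) ψ(w)` with `ψ` merely integrable. -/
lemma tendsto_integral_mul_of_tendsto_integral_prod {Ω S T ι : Type*} [MeasurableSpace Ω]
    {P : Measure Ω} [IsFiniteMeasure P] [TopologicalSpace S] [MeasurableSpace S]
    [OpensMeasurableSpace S] [PseudoMetricSpace T] [MeasurableSpace T] [BorelSpace T]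
    {l : Filter ι} {X : ι → Ω → S} {Y : Ω → S} {W : Ω → T} (hX : ∀ n, Measurable (X n))
    (hY : Measurable Y) (hW : Measurable W)
    (hweak : ∀ f : (S × T) →ᵇ ℝ,
      Tendsto (fun n => ∫ ω, f (X n ω, W ω) ∂P) l (𝓝 (∫ ω, f (Y ω, W ω) ∂P)))
    (f : S →ᵇ ℝ) {ψ : T → ℝ} (hψ : Integrable ψ (P.map W)) :
    Tendsto (fun n => ∫ ω, f (X n ω) * ψ (W ω) ∂P) l (𝓝 (∫ ω, f (Y ω) * ψ (W ω) ∂P)) := by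
  refine Metric.tendsto_nhds.2 fun ε hε => ?_
  have hM : 0 < ‖f‖ + 1 := by positivity
  obtain ⟨g, hg, hgi⟩ := hψ.exists_boundedContinuous_integral_sub_le
    (ε := ε / 3 / (‖f‖ + 1)) (by positivity)
  have hle : ‖f‖ * ∫ x, ‖ψ x - g x‖ ∂(P.map W) ≤ ε / 3 := by
    calc _ ≤ (‖f‖ + 1) * (ε / 3 / (‖f‖ + 1)) := by gcongr; linarith
      _ = ε / 3 := by field_simp
  have hprod := hweak (f.compContinuous ⟨Prod.fst, continuous_fst⟩ *
    g.compContinuous ⟨Prod.snd, continuous_snd⟩)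
  filter_upwards [Metric.tendsto_nhds.1 hprod (ε / 3) (by positivity)] with n hn
  simp only [BoundedContinuousFunction.coe_mul, Pi.mul_apply,
    BoundedContinuousFunction.compContinuous_apply, ContinuousMap.coe_mk, Real.dist_eq] at hn ⊢
  have h₁ := (abs_integral_mul_sub_integral_mul_le (hX n) hW f hψ hgi).trans hle
  have h₂ := (abs_integral_mul_sub_integral_mul_le hY hW f hψ hgi).trans hle
  rw [abs_le] at h₁ h₂
  rw [abs_lt] at hn ⊢
  constructor <;> linarith [h₁.1, h₁.2, h₂.1, h₂.2, hn.1, hn.2]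

/-- Convergence in probability on an event `W ∈ A` on which the limit `H(W)` stays in a small
ball. -/
lemma tendsto_measureReal_inter_of_tendsto_integral_prod {Ω S T ι : Type*} [MeasurableSpace Ω]
    {P : Measure Ω} [IsFiniteMeasure P] [PseudoMetricSpace S] [MeasurableSpace S]
    [OpensMeasurableSpace S] [PseudoMetricSpace T] [MeasurableSpace T] [BorelSpace T]
    {l : Filter ι} {X : ι → Ω → S} {W : Ω → T} {H : T → S} (hX : ∀ n, Measurable (X n))
    (hW : Measurable W) (hH : Measurable H)
    (hweak : ∀ f : (S × T) →ᵇ ℝ,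
      Tendsto (fun n => ∫ ω, f (X n ω, W ω) ∂P) l (𝓝 (∫ ω, f (H (W ω), W ω) ∂P)))
    {δ : ℝ} (hδ : 0 < δ) {A : Set T} (hA : MeasurableSet A) {c : S}
    (hAc : A ⊆ H ⁻¹' Metric.ball c (δ / 3)) :
    Tendsto (fun n => P.real ({ω | δ < dist (X n ω) (H (W ω))} ∩ W ⁻¹' A)) l (𝓝 0) := by
  let f : S →ᵇ ℝ := BoundedContinuousFunction.ofNormedAddCommGroup
    (fun s => min 1 (max 0 ((dist s c - δ / 3) * (3 / δ)))) (by fun_prop) 1 fun s => by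
      rw [Real.norm_eq_abs, abs_of_nonneg (by positivity)]
      exact min_le_left _ _
  have hf_apply : ∀ s, f s = min 1 (max 0 ((dist s c - δ / 3) * (3 / δ))) := fun _ => rfl
  have hf_nonneg : ∀ s, 0 ≤ f s := fun s => by rw [hf_apply]; positivity
  have hψ : Integrable (A.indicator (1 : T → ℝ)) (P.map W) :=
    (integrable_const (1 : ℝ)).indicator hA
  have hlim := tendsto_integral_mul_of_tendsto_integral_prod hX (hH.comp hW) hW hweak f hψ
  have hzero : ∀ ω, f ((H ∘ W) ω) * A.indicator (1 : T → ℝ) (W ω) = 0 := fun ω => by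
    by_cases hω : W ω ∈ A
    · have hd : dist (H (W ω)) c < δ / 3 := hAc hω
      have : (dist (H (W ω)) c - δ / 3) * (3 / δ) ≤ 0 :=
        mul_nonpos_of_nonpos_of_nonneg (by linarith) (by positivity)
      simp [hf_apply, max_eq_left this]
    · simp [hω]
  simp only [hzero, integral_zero] at hlim
  refine squeeze_zero (fun _ => measureReal_nonneg) (fun n => ?_) hlim
  have hint : Integrable (fun ω => f (X n ω) * A.indicator (1 : T → ℝ) (W ω)) P :=
    (hψ.comp_measurable hW).bdd_mul (f.continuous.measurable.comp (hX n)).aestronglyMeasurable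
      (.of_forall fun ω => f.norm_coe_le_norm (X n ω))
  have hnonneg : ∀ ω, 0 ≤ f (X n ω) * A.indicator (1 : T → ℝ) (W ω) := fun ω =>
    mul_nonneg (hf_nonneg _) (Set.indicator_nonneg (fun _ _ => zero_le_one) _)
  have hmarkov := mul_meas_ge_le_integral_of_nonneg (.of_forall hnonneg) hint 1
  rw [one_mul] at hmarkov
  refine (measureReal_mono fun ω hω => ?_).trans hmarkov
  obtain ⟨hωδ, hωA⟩ := hω
  have hd : dist (H (W ω)) c < δ / 3 := hAc hωA
  have hωδ : δ < dist (X n ω) (H (W ω)) := hωδ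
  have htri := dist_triangle_right (X n ω) (H (W ω)) c
  have hge : 1 ≤ (dist (X n ω) c - δ / 3) * (3 / δ) := by
    rw [mul_div_assoc', le_div_iff₀ hδ]
    linarith
  have hωA : W ω ∈ A := hωA
  simp [hf_apply, hωA, hge]

/-- Let `Ω` be a probability space, `S, T` Polish spaces with their Borel
σ-algebras, `Xₙ : Ω → S`, `W : Ω → T` measurable and `H : T → S` Borel measurable.  If the
laws of `(Xₙ, W)` converge weakly to the law of `(H∘W, W)`, then `Xₙ → H∘W` in
probability: for every `δ > 0`, `P[dist(Xₙ, H(W)) > δ] → 0`. -/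
theorem stmt8 {Ω : Type*} [MeasurableSpace Ω] (P : Measure Ω) [IsProbabilityMeasure P]
    {S : Type*} [MetricSpace S] [CompleteSpace S] [TopologicalSpace.SeparableSpace S]
    [MeasurableSpace S] [BorelSpace S]
    {T : Type*} [MetricSpace T] [CompleteSpace T] [TopologicalSpace.SeparableSpace T]
    [MeasurableSpace T] [BorelSpace T]
    (X : ℕ → Ω → S) (W : Ω → T) (H : T → S)
    (hX : ∀ n, Measurable (X n)) (hW : Measurable W) (hH : Measurable H)
    (hweak : ∀ f : BoundedContinuousFunction (S × T) ℝ,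
      Tendsto (fun n => ∫ ω, f (X n ω, W ω) ∂P) atTop
        (nhds (∫ ω, f (H (W ω), W ω) ∂P))) :
    ∀ δ : ℝ, 0 < δ →
      Tendsto (fun n => P {ω | δ < dist (X n ω) (H (W ω))}) atTop (nhds 0) := by
  intro δ hδ
  rcases isEmpty_or_nonempty S with hS | hS
  · have : IsEmpty Ω := ⟨fun ω => hS.elim (H (W ω))⟩
    simp [Set.eq_empty_of_isEmpty]
  have : SecondCountableTopology S := UniformSpace.secondCountable_of_separable S
  let c := TopologicalSpace.denseSeq S
  let A : ℕ → Set T := disjointed fun k => H ⁻¹' Metric.ball (c k) (δ / 3)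
  have hA : ∀ k, MeasurableSet (A k) := fun k =>
    MeasurableSet.disjointed (fun k => hH measurableSet_ball) k
  have hAunion : ⋃ k, A k = Set.univ := by
    rw [iUnion_disjointed, Set.eq_univ_iff_forall]
    intro t
    obtain ⟨k, hk⟩ := (TopologicalSpace.denseRange_denseSeq S).exists_dist_lt (H t)
      (by positivity : 0 < δ / 3)
    exact Set.mem_iUnion.2 ⟨k, hk⟩
  have hAdisj : Pairwise (Function.onFun Disjoint fun k => W ⁻¹' A k) := fun i j hij =>
    (disjoint_disjointed _ hij).preimage W
  have hsum : ∀ s : Set Ω, MeasurableSet s →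
      HasSum (fun k => P.real (s ∩ W ⁻¹' A k)) (P.real s) := fun s hs => by
    have h : ∑' k, P (s ∩ W ⁻¹' A k) = P s := by
      rw [← measure_iUnion
        (fun i j hij => (hAdisj hij).mono Set.inter_subset_right Set.inter_subset_right)
        (fun k => hs.inter (hW (hA k))), ← Set.inter_iUnion, ← Set.preimage_iUnion, hAunion,
        Set.preimage_univ, Set.inter_univ]
    have h' := ENNReal.hasSum_toReal (h.trans_ne (measure_ne_top P s))
    rwa [← ENNReal.tsum_toReal_eq fun k => measure_ne_top P _, h] at h'
  have hmeas : ∀ n, MeasurableSet {ω | δ < dist (X n ω) (H (W ω))} := fun n =>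
    measurableSet_lt measurable_const ((hX n).dist (hH.comp hW))
  have hreal := tendsto_tsum_of_dominated_convergence
    (hsum Set.univ MeasurableSet.univ).summable
    (fun k => tendsto_measureReal_inter_of_tendsto_integral_prod hX hW hH hweak hδ (hA k)
      (disjointed_subset _ k))
    (.of_forall fun n k => by
      rw [Real.norm_of_nonneg measureReal_nonneg]
      exact measureReal_mono (Set.inter_subset_inter_left _ (Set.subset_univ _)))
  simp only [tsum_zero, (hsum _ (hmeas _)).tsum_eq] at hreal
  exact (ENNReal.tendsto_toReal_iff (fun _ => measure_ne_top _ _) ENNReal.zero_ne_top).1 hreal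
end

section
/- Let Ω be a probability space, let S be a separable metric space with metric dist and Borel σ-algebra, and let Xₙ, X : Ω → S (n ∈ ℕ) be measurable. If for every bounded continuous function F : S → ℝ one has E[ (F(Xₙ) − F(X))² ] → 0 as n → ∞, then Xₙ converges to X in probability, i.e. for every δ > 0, P[ dist(Xₙ, X) > δ ] → 0 as n → ∞. -/
open Filter MeasureTheory

/-- On a finite measure space covered by countably many measurable sets, a sequence of sets has
measure tending to zero as soon as its trace on each piece of the cover does. -/
theorem tendsto_measure_zero_of_forall_inter_cover {Ω : Type*} [MeasurableSpace Ω]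
    {μ : Measure Ω} [IsFiniteMeasure μ] {A B : ℕ → Set Ω} (hB : ∀ k, MeasurableSet (B k))
    (hcover : ⋃ k, B k = Set.univ)
    (h : ∀ k, Tendsto (fun n => μ (A n ∩ B k)) atTop (nhds 0)) :
    Tendsto (fun n => μ (A n)) atTop (nhds 0) := by
  have hacc : Tendsto (fun K => μ (⋃ k ∈ Finset.range K, B k)ᶜ) atTop (nhds 0) := by
    have hinter : ⋂ K, (⋃ k ∈ Finset.range K, B k)ᶜ = ∅ := by
      refine Set.eq_empty_of_forall_notMem fun ω hω => ?_
      obtain ⟨k, hk⟩ := Set.mem_iUnion.1 (hcover ▸ Set.mem_univ ω)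
      exact Set.mem_iInter.1 hω (k + 1) (Set.mem_biUnion (by simp) hk)
    rw [← measure_empty (μ := μ), ← hinter]
    refine tendsto_measure_iInter_atTop (fun K => ?_) (fun K L hKL => ?_)
      ⟨0, measure_ne_top μ _⟩
    · exact (Finset.measurableSet_biUnion _ fun k _ => hB k).compl.nullMeasurableSet
    · exact Set.compl_subset_compl.2
        (Set.biUnion_subset_biUnion_left (Finset.range_subset_range.2 hKL))
  rw [ENNReal.tendsto_nhds_zero] at hacc ⊢
  intro ε hε
  have hε2 : 0 < ε / 2 := ENNReal.half_pos hε.ne'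
  obtain ⟨K, hK⟩ := (hacc _ hε2).exists
  have hsum : Tendsto (fun n => ∑ k ∈ Finset.range K, μ (A n ∩ B k)) atTop (nhds 0) := by
    simpa using tendsto_finsetSum (Finset.range K) fun k _ => h k
  filter_upwards [ENNReal.tendsto_nhds_zero.1 hsum _ hε2] with n hn
  calc μ (A n) ≤ μ ((⋃ k ∈ Finset.range K, A n ∩ B k) ∪ (⋃ k ∈ Finset.range K, B k)ᶜ) := by
        refine measure_mono fun ω hω => ?_
        by_cases hmem : ω ∈ ⋃ k ∈ Finset.range K, B k
        · left
          rw [← Set.inter_iUnion₂]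
          exact ⟨hω, hmem⟩
        · exact Or.inr hmem
    _ ≤ ∑ k ∈ Finset.range K, μ (A n ∩ B k) + μ (⋃ k ∈ Finset.range K, B k)ᶜ :=
        (measure_union_le _ _).trans (add_le_add_left (measure_biUnion_finset_le _ _) _)
    _ ≤ ε / 2 + ε / 2 := add_le_add hn hK
    _ = ε := ENNReal.add_halves ε

/-- The distance to `x`, truncated at the level `R`, as a bounded continuous function. -/
noncomputable def truncatedDist {S : Type*} [PseudoMetricSpace S] (x : S) {R : ℝ} (hR : 0 ≤ R) :
    BoundedContinuousFunction S ℝ :=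
  BoundedContinuousFunction.ofNormedAddCommGroup (fun y => min (dist y x) R) (by fun_prop) R
    fun y => by
      rw [Real.norm_of_nonneg (le_min dist_nonneg hR)]
      exact min_le_right _ _

/-- Let `Ω` be a probability space, `S` a separable metric space with its
Borel σ-algebra, `Xₙ, X : Ω → S` measurable.  If `E[(F(Xₙ) − F(X))²] → 0` for every
bounded continuous `F : S → ℝ`, then `Xₙ → X` in probability: for every `δ > 0`,
`P[dist(Xₙ, X) > δ] → 0`. -/
theorem stmt9 {Ω : Type*} [MeasurableSpace Ω] (P : Measure Ω) [IsProbabilityMeasure P]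
    {S : Type*} [MetricSpace S] [TopologicalSpace.SeparableSpace S]
    [MeasurableSpace S] [BorelSpace S]
    (X : ℕ → Ω → S) (Xlim : Ω → S)
    (hX : ∀ n, Measurable (X n)) (hXlim : Measurable Xlim)
    (hL2 : ∀ F : BoundedContinuousFunction S ℝ,
      Tendsto (fun n => ∫ ω, (F (X n ω) - F (Xlim ω)) ^ 2 ∂P) atTop (nhds 0)) :
    ∀ δ : ℝ, 0 < δ →
      Tendsto (fun n => P {ω | δ < dist (X n ω) (Xlim ω)}) atTop (nhds 0) := by
  intro δ hδ
  have : Nonempty Ω := nonempty_of_isProbabilityMeasure P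
  have : Nonempty S := this.map Xlim
  obtain ⟨r, hr, hrδ⟩ : ∃ r : ℝ, 0 < r ∧ 3 * r ≤ δ := ⟨δ / 3, by positivity, by linarith⟩
  let x : ℕ → S := TopologicalSpace.denseSeq S
  refine tendsto_measure_zero_of_forall_inter_cover
    (B := fun k => Xlim ⁻¹' Metric.ball (x k) r)
    (fun k => hXlim Metric.isOpen_ball.measurableSet) ?_ fun k => ?_
  · refine Set.eq_univ_of_forall fun ω => Set.mem_iUnion.2 ?_
    exact (TopologicalSpace.denseRange_denseSeq S).exists_dist_lt (Xlim ω) hr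
  let F := truncatedDist (x k) (R := 2 * r) (by positivity)
  have hF (y : S) : F y = min (dist y (x k)) (2 * r) := rfl
  have hint (n : ℕ) : Integrable (fun ω => (F (X n ω) - F (Xlim ω)) ^ 2) P := by
    have hmeas := ((F.continuous.measurable.comp (hX n)).sub
      (F.continuous.measurable.comp hXlim)).pow_const 2
    refine Integrable.of_bound hmeas.aestronglyMeasurable ((2 * r) ^ 2)
      (Eventually.of_forall fun ω => ?_)
    have h₁ := hF (X n ω)
    have h₂ := hF (Xlim ω)
    have h₃ : 0 ≤ F (X n ω) := h₁ ▸ le_min dist_nonneg (by positivity)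
    have h₄ : 0 ≤ F (Xlim ω) := h₂ ▸ le_min dist_nonneg (by positivity)
    have h₅ : F (X n ω) ≤ 2 * r := h₁ ▸ min_le_right _ _
    have h₆ : F (Xlim ω) ≤ 2 * r := h₂ ▸ min_le_right _ _
    simp only [norm_pow, Real.norm_eq_abs]
    gcongr
    exact abs_sub_le_iff.2 ⟨by linarith, by linarith⟩
  have hlim : Tendsto (fun n => ENNReal.ofReal
      ((∫ ω, (F (X n ω) - F (Xlim ω)) ^ 2 ∂P) / r ^ 2)) atTop (nhds 0) := by
    simpa using ENNReal.tendsto_ofReal ((hL2 F).div_const (r ^ 2))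
  refine tendsto_of_tendsto_of_tendsto_of_le_of_le tendsto_const_nhds hlim
    (fun _ => zero_le) fun n => ?_
  have hmarkov := mul_meas_ge_le_integral_of_nonneg
    (Eventually.of_forall fun ω => sq_nonneg (F (X n ω) - F (Xlim ω))) (hint n) (r ^ 2)
  refine (measure_mono ?_).trans
    ((ENNReal.le_ofReal_iff_toReal_le (measure_ne_top P _) (by positivity)).2
      ((le_div_iff₀' (by positivity)).2 hmarkov))
  rintro ω ⟨hω, hball⟩
  have hball' : dist (Xlim ω) (x k) < r := hball
  have hfar : 2 * r ≤ dist (X n ω) (x k) := by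
    have := dist_triangle_right (X n ω) (Xlim ω) (x k)
    have hω' : δ < dist (X n ω) (Xlim ω) := hω
    linarith
  have h₁ : F (X n ω) = 2 * r := by rw [hF, min_eq_right hfar]
  have h₂ : F (Xlim ω) ≤ r := (hF _).trans_le ((min_le_left _ _).trans hball'.le)
  exact pow_le_pow_left₀ hr.le (by linarith) 2
end

section
/- Let S and T be Polish spaces equipped with their Borel σ-algebras, let μₙ (n ∈ ℕ) and μ be Borel probability measures on the product S × T such that μₙ converges weakly to μ, and suppose there is a Borel probability measure ν on T such that the T-marginal (pushforward under the projection S × T → T) of every μₙ and of μ equals ν. Then for every bounded continuous F : S → ℝ and every bounded Borel measurable G : T → ℝ, ∫_{S×T} F(x)G(y) dμₙ(x,y) → ∫_{S×T} F(x)G(y) dμ(x,y) as n → ∞. -/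
open Filter MeasureTheory

/-- Replacing `G` by `g` in `∫ F(x)G(y) dρ` changes the integral by at most `‖F‖` times the
`L¹` distance of `G` and `g` under the second marginal of `ρ`. -/
theorem abs_integral_fst_mul_snd_sub_le
    {S T : Type*} [TopologicalSpace S] [MeasurableSpace S] [OpensMeasurableSpace S]
    [MeasurableSpace T] (ρ : Measure (S × T)) (F : BoundedContinuousFunction S ℝ) {G g : T → ℝ}
    (hG : Integrable G (ρ.map Prod.snd)) (hg : Integrable g (ρ.map Prod.snd)) :
    |∫ p, F p.1 * G p.2 ∂ρ - ∫ p, F p.1 * g p.2 ∂ρ| ≤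
      ‖F‖ * ∫ y, ‖G y - g y‖ ∂(ρ.map Prod.snd) := by
  have hint {h : T → ℝ} (hh : Integrable h (ρ.map Prod.snd)) :
      Integrable (fun p : S × T => F p.1 * h p.2) ρ :=
    (hh.comp_measurable measurable_snd).bdd_mul
      (F.continuous.measurable.comp measurable_fst).aestronglyMeasurable
      (ae_of_all _ fun p => F.norm_coe_le_norm p.1)
  have hsub : Integrable (fun p : S × T => ‖G p.2 - g p.2‖) ρ :=
    ((hG.sub hg).comp_measurable measurable_snd).norm
  rw [← integral_sub (hint hG) (hint hg),
    integral_map (f := fun y => ‖G y - g y‖) measurable_snd.aemeasurable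
      (hG.sub hg).norm.aestronglyMeasurable,
    ← integral_const_mul, ← Real.norm_eq_abs]
  refine norm_integral_le_of_norm_le (hsub.const_mul _) (ae_of_all _ fun p => ?_)
  rw [← mul_sub, norm_mul]
  exact mul_le_mul_of_nonneg_right (F.norm_coe_le_norm p.1) (norm_nonneg _)

/-- Let `S, T` be Polish spaces with their Borel σ-algebras, `μₙ, μ`
Borel probability measures on `S × T` with `μₙ → μ` weakly, and suppose all `μₙ` and `μ`
have the same `T`-marginal `ν`.  Then for every bounded continuous `F : S → ℝ` and every
bounded Borel measurable `G : T → ℝ`,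
`∫ F(x)G(y) dμₙ(x,y) → ∫ F(x)G(y) dμ(x,y)`. -/
theorem stmt10
    {S : Type*} [MetricSpace S] [CompleteSpace S] [TopologicalSpace.SeparableSpace S]
    [MeasurableSpace S] [BorelSpace S]
    {T : Type*} [MetricSpace T] [CompleteSpace T] [TopologicalSpace.SeparableSpace T]
    [MeasurableSpace T] [BorelSpace T]
    (μ : ℕ → Measure (S × T)) (μlim : Measure (S × T))
    [∀ n, IsProbabilityMeasure (μ n)] [IsProbabilityMeasure μlim]
    (hweak : ∀ f : BoundedContinuousFunction (S × T) ℝ,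
      Tendsto (fun n => ∫ p, f p ∂(μ n)) atTop (nhds (∫ p, f p ∂μlim)))
    (ν : Measure T) [IsProbabilityMeasure ν]
    (hmarg : ∀ n, (μ n).map Prod.snd = ν) (hmarglim : μlim.map Prod.snd = ν)
    (F : BoundedContinuousFunction S ℝ) (G : T → ℝ)
    (hG : Measurable G) (hGbd : ∃ C : ℝ, ∀ y, |G y| ≤ C) :
    Tendsto (fun n => ∫ p, F p.1 * G p.2 ∂(μ n)) atTop
      (nhds (∫ p, F p.1 * G p.2 ∂μlim)) := by
  obtain ⟨C, hC⟩ := hGbd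
  have hGint : Integrable G ν :=
    Integrable.of_bound hG.aestronglyMeasurable C (ae_of_all _ hC)
  rw [Metric.tendsto_atTop]
  intro ε hε
  have hF : 0 < ‖F‖ + 1 := by positivity
  obtain ⟨g, hgε, hg⟩ := hGint.exists_boundedContinuous_integral_sub_le
    (ε := ε / (4 * (‖F‖ + 1))) (by positivity)
  have hclose (ρ : Measure (S × T)) (hρ : ρ.map Prod.snd = ν) :
      |∫ p, F p.1 * G p.2 ∂ρ - ∫ p, F p.1 * g p.2 ∂ρ| ≤ ε / 4 := by
    subst hρ
    calc _ ≤ ‖F‖ * ∫ y, ‖G y - g y‖ ∂(ρ.map Prod.snd) :=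
          abs_integral_fst_mul_snd_sub_le ρ F hGint hg
      _ ≤ (‖F‖ + 1) * (ε / (4 * (‖F‖ + 1))) := by gcongr; linarith
      _ = ε / 4 := by field_simp
  have hlim : Tendsto (fun n => ∫ p, F p.1 * g p.2 ∂(μ n)) atTop
      (nhds (∫ p, F p.1 * g p.2 ∂μlim)) :=
    hweak (F.compContinuous ⟨Prod.fst, continuous_fst⟩ *
      g.compContinuous ⟨Prod.snd, continuous_snd⟩)
  obtain ⟨N, hN⟩ := Metric.tendsto_atTop.1 hlim (ε / 2) (by positivity)
  refine ⟨N, fun n hn => ?_⟩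
  have h₁ := abs_le.1 (hclose (μ n) (hmarg n))
  have h₂ := abs_le.1 (hclose μlim hmarglim)
  have h₃ := hN n hn
  rw [Real.dist_eq, abs_lt] at h₃ ⊢
  constructor <;> linarith [h₁.1, h₁.2, h₂.1, h₂.2, h₃.1, h₃.2]
end
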